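/- Assume all Ising couplings are nonnegative. Then for every B ⊆ Λ, every A ⊆ Λ, and every β > 0, the Ising Gibbs expectation ⟨s_B⟩ is nondecreasing in the coupling J_A: if J_A ≤ J̃_A and all other couplings are equal and nonnegative, then ⟨s_B⟩ computed with J_A is ≤ ⟨s_B⟩ computed with J̃_A. -/

import Mathlib

open MeasureTheory Real

/-- The ±1 value of an Ising spin encoded by a Boolean. -/
def isingSpin (b : Bool) : ℝ := if b then 1 else -1

/-- Ising Hamiltonian with many-body couplings: `H(s) = −Σ_{A⊆Λ} J_A ∏_{x∈A} s_x`. -/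
noncomputable def isingHam {Λ : Type*} [Fintype Λ] (J : Finset Λ → ℝ) (s : Λ → Bool) : ℝ :=
  - ∑ A : Finset Λ, J A * ∏ x ∈ A, isingSpin (s x)

/-- Ising Gibbs expectation at inverse temperature `β`:
`⟨f⟩ = Z⁻¹ Σ_s f(s) e^{−βH(s)}`. -/
noncomputable def isingGibbs {Λ : Type*} [Fintype Λ] [DecidableEq Λ] (J : Finset Λ → ℝ)
    (β : ℝ) (f : (Λ → Bool) → ℝ) : ℝ :=
  (∑ s : Λ → Bool, f s * Real.exp (-β * isingHam J s)) /
  (∑ s : Λ → Bool, Real.exp (-β * isingHam J s))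

/-- `s_B = ∏_{x∈B} s_x`. -/
def isingSigma {Λ : Type*} (B : Finset Λ) (s : Λ → Bool) : ℝ :=
  ∏ x ∈ B, isingSpin (s x)

theorem isingSpin_mul_self (b : Bool) : isingSpin b * isingSpin b = 1 := by
  cases b <;> simp [isingSpin]

theorem isingSpin_beq (a b : Bool) : isingSpin (a == b) = isingSpin a * isingSpin b := by
  cases a <;> cases b <;> simp [isingSpin]

theorem isingSigma_mul_self {Λ : Type*} (B : Finset Λ) (s : Λ → Bool) :
    isingSigma B s * isingSigma B s = 1 := by
  simp only [isingSigma, ← Finset.prod_mul_distrib, isingSpin_mul_self, Finset.prod_const_one]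

theorem isingSigma_beq {Λ : Type*} (B : Finset Λ) (s u : Λ → Bool) :
    isingSigma B (fun x => s x == u x) = isingSigma B s * isingSigma B u := by
  simp only [isingSigma, isingSpin_beq, Finset.prod_mul_distrib]

theorem isingSigma_eq_one_or_neg_one {Λ : Type*} (B : Finset Λ) (s : Λ → Bool) :
    isingSigma B s = 1 ∨ isingSigma B s = -1 :=
  mul_self_eq_one_iff.mp (isingSigma_mul_self B s)

theorem isingSigma_symmDiff {Λ : Type*} [DecidableEq Λ] (B C : Finset Λ) (s : Λ → Bool) :
    isingSigma (symmDiff B C) s = isingSigma B s * isingSigma C s := by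
  have hB : isingSigma B s = isingSigma (B \ C) s * isingSigma (B ∩ C) s := by
    rw [mul_comm]; exact (Finset.prod_inter_mul_prod_sdiff B C _).symm
  have hC : isingSigma C s = isingSigma (C \ B) s * isingSigma (B ∩ C) s := by
    rw [mul_comm, Finset.inter_comm]; exact (Finset.prod_inter_mul_prod_sdiff C B _).symm
  have hD : isingSigma (symmDiff B C) s = isingSigma (B \ C) s * isingSigma (C \ B) s :=
    Finset.prod_union disjoint_sdiff_sdiff
  rw [hB, hC, hD]
  linear_combination
    -(isingSigma (B \ C) s * isingSigma (C \ B) s) * isingSigma_mul_self (B ∩ C) s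

theorem exp_mul_isingSigma {Λ : Type*} (t : ℝ) (B : Finset Λ) (s : Λ → Bool) :
    Real.exp (t * isingSigma B s) = Real.cosh t + Real.sinh t * isingSigma B s := by
  rcases isingSigma_eq_one_or_neg_one B s with h | h
  · rw [h, mul_one, mul_one, Real.cosh_add_sinh]
  · rw [h, mul_neg_one, mul_neg_one, ← sub_eq_add_neg, Real.cosh_sub_sinh]

theorem sum_isingSigma_nonneg {Λ : Type*} [Fintype Λ] [DecidableEq Λ] (D : Finset Λ) :
    0 ≤ ∑ s : Λ → Bool, isingSigma D s := by
  have h : ∀ s : Λ → Bool, isingSigma D s = ∏ x, if x ∈ D then isingSpin (s x) else 1 := by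
    intro s
    simp [isingSigma, Finset.prod_ite_mem]
  simp only [h]
  rw [← Fintype.prod_sum (fun x b => if x ∈ D then isingSpin b else (1 : ℝ))]
  refine Finset.prod_nonneg fun x _ => ?_
  by_cases hx : x ∈ D <;> simp [hx, isingSpin]

/-- First Griffiths inequality, unnormalized, for interactions supported on a family `S`. -/
theorem griffiths_first {Λ : Type*} [Fintype Λ] [DecidableEq Λ]
    (K : Finset Λ → ℝ) (hK : ∀ C, 0 ≤ K C) (S : Finset (Finset Λ)) (D : Finset Λ) :
    0 ≤ ∑ s : Λ → Bool, isingSigma D s * Real.exp (∑ C ∈ S, K C * isingSigma C s) := by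
  induction S using Finset.induction_on generalizing D with
  | empty => simpa using sum_isingSigma_nonneg D
  | insert C S hC ih =>
    have h : ∀ s : Λ → Bool,
        isingSigma D s * Real.exp (∑ C ∈ insert C S, K C * isingSigma C s) =
        Real.cosh (K C) * (isingSigma D s * Real.exp (∑ C ∈ S, K C * isingSigma C s)) +
        Real.sinh (K C) *
          (isingSigma (symmDiff D C) s * Real.exp (∑ C ∈ S, K C * isingSigma C s)) := by
      intro s
      rw [Finset.sum_insert hC, Real.exp_add, exp_mul_isingSigma, isingSigma_symmDiff]
      ring
    simp only [h, Finset.sum_add_distrib, ← Finset.mul_sum]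
    exact add_nonneg (mul_nonneg (Real.cosh_pos _).le (ih D))
      (mul_nonneg (Real.sinh_nonneg_iff.mpr (hK C)) (ih _))

/-- Change of variables `t = s * u` in a sum over the second of two spin configurations. -/
theorem sum_beq {Λ : Type*} [Fintype Λ] [DecidableEq Λ] (s : Λ → Bool)
    (f : (Λ → Bool) → ℝ) : ∑ u : Λ → Bool, f (fun x => s x == u x) = ∑ t, f t := by
  have hinv : Function.Involutive (fun (u : Λ → Bool) x => s x == u x) := by
    intro u
    funext x
    change (s x == (s x == u x)) = u x
    cases s x <;> cases u x <;> rfl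
  exact hinv.bijective.sum_comp f

/-- Second Griffiths inequality, unnormalized. -/
theorem griffiths_second {Λ : Type*} [Fintype Λ] [DecidableEq Λ]
    (K : Finset Λ → ℝ) (hK : ∀ C, 0 ≤ K C) (A B : Finset Λ) :
    (∑ s : Λ → Bool, isingSigma B s * Real.exp (∑ C, K C * isingSigma C s)) *
      (∑ s : Λ → Bool, isingSigma A s * Real.exp (∑ C, K C * isingSigma C s)) ≤
    (∑ s : Λ → Bool, isingSigma B s * isingSigma A s * Real.exp (∑ C, K C * isingSigma C s)) *
      (∑ s : Λ → Bool, Real.exp (∑ C, K C * isingSigma C s)) := by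
  rw [← sub_nonneg, Finset.sum_mul_sum, Finset.sum_mul_sum, ← Finset.sum_sub_distrib]
  simp only [← Finset.sum_sub_distrib]
  have hchange : ∀ s : Λ → Bool,
      ∑ t : Λ → Bool,
        (isingSigma B s * isingSigma A s * Real.exp (∑ C, K C * isingSigma C s) *
            Real.exp (∑ C, K C * isingSigma C t) -
          isingSigma B s * Real.exp (∑ C, K C * isingSigma C s) *
            (isingSigma A t * Real.exp (∑ C, K C * isingSigma C t))) =
      ∑ u : Λ → Bool, (1 - isingSigma A u) * (isingSigma (symmDiff B A) s *
        Real.exp (∑ C, (K C * (1 + isingSigma C u)) * isingSigma C s)) := by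
    intro s
    rw [← sum_beq s]
    refine Finset.sum_congr rfl fun u _ => ?_
    have he : Real.exp (∑ C, (K C * (1 + isingSigma C u)) * isingSigma C s) =
        Real.exp (∑ C, K C * isingSigma C s) *
          Real.exp (∑ C, K C * (isingSigma C s * isingSigma C u)) := by
      rw [← Real.exp_add, ← Finset.sum_add_distrib]
      congr 1
      exact Finset.sum_congr rfl fun C _ => by ring
    simp only [isingSigma_beq]
    rw [he, isingSigma_symmDiff]
    ring
  simp only [hchange]
  rw [Finset.sum_comm]
  refine Finset.sum_nonneg fun u _ => ?_
  rw [← Finset.mul_sum]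
  have hbound : ∀ C, 0 ≤ 1 - isingSigma C u ∧ 0 ≤ 1 + isingSigma C u := by
    intro C
    rcases isingSigma_eq_one_or_neg_one C u with h | h <;> rw [h] <;> norm_num
  exact mul_nonneg (hbound A).1
    (griffiths_first _ (fun C => mul_nonneg (hK C) (hbound C).2) Finset.univ _)

theorem neg_mul_isingHam {Λ : Type*} [Fintype Λ] (J : Finset Λ → ℝ) (β : ℝ) (s : Λ → Bool) :
    -β * isingHam J s = ∑ C, β * J C * isingSigma C s := by
  simp only [isingHam, neg_mul_neg, Finset.mul_sum, isingSigma, mul_assoc]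

/-- Monotonicity of Ising correlations in the couplings: `⟨s_B⟩` is nondecreasing in `J_A`
when all couplings are nonnegative. -/
theorem ising_monotone_couplings {Λ : Type*} [Fintype Λ] [DecidableEq Λ]
    (J J' : Finset Λ → ℝ)
    (hJ : ∀ A : Finset Λ, 0 ≤ J A) (hJ' : ∀ A : Finset Λ, 0 ≤ J' A)
    (B A : Finset Λ) (hagree : ∀ C : Finset Λ, C ≠ A → J C = J' C) (hle : J A ≤ J' A)
    (β : ℝ) (hβ : 0 < β) :
    isingGibbs J β (isingSigma B) ≤ isingGibbs J' β (isingSigma B) := by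
  have hexp : ∀ s : Λ → Bool, Real.exp (-β * isingHam J' s) =
      Real.exp (∑ C, β * J C * isingSigma C s) *
        (Real.cosh (β * (J' A - J A)) + Real.sinh (β * (J' A - J A)) * isingSigma A s) := by
    intro s
    rw [← exp_mul_isingSigma, ← Real.exp_add, neg_mul_isingHam]
    congr 1
    rw [← sub_eq_iff_eq_add', ← Finset.sum_sub_distrib,
      Finset.sum_eq_single A (fun C _ hC => by rw [hagree C hC, sub_self]) (by simp)]
    ring
  have hsinh : 0 ≤ Real.sinh (β * (J' A - J A)) :=
    Real.sinh_nonneg_iff.mpr (mul_nonneg hβ.le (sub_nonneg.mpr hle))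
  have hgriffiths := griffiths_second (fun C => β * J C) (fun C => mul_nonneg hβ.le (hJ C)) A B
  unfold isingGibbs
  rw [div_le_div_iff₀ (Finset.sum_pos (fun s _ => Real.exp_pos _) Finset.univ_nonempty)
    (Finset.sum_pos (fun s _ => Real.exp_pos _) Finset.univ_nonempty)]
  simp only [hexp, neg_mul_isingHam J]
  set c := Real.cosh (β * (J' A - J A))
  set r := Real.sinh (β * (J' A - J A))
  set w : (Λ → Bool) → ℝ := fun s => Real.exp (∑ C, β * J C * isingSigma C s)
  have hZ : ∑ s, w s * (c + r * isingSigma A s) =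
      c * ∑ s, w s + r * ∑ s, isingSigma A s * w s := by
    rw [Finset.mul_sum, Finset.mul_sum, ← Finset.sum_add_distrib]
    exact Finset.sum_congr rfl fun s _ => by ring
  have hN : ∑ s, isingSigma B s * (w s * (c + r * isingSigma A s)) =
      c * ∑ s, isingSigma B s * w s + r * ∑ s, isingSigma B s * isingSigma A s * w s := by
    rw [Finset.mul_sum, Finset.mul_sum, ← Finset.sum_add_distrib]
    exact Finset.sum_congr rfl fun s _ => by ring
  change (∑ s, isingSigma B s * w s) * ∑ s, w s * (c + r * isingSigma A s) ≤
    (∑ s, isingSigma B s * (w s * (c + r * isingSigma A s))) * ∑ s, w s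
  rw [hZ, hN]
  linarith [mul_le_mul_of_nonneg_left hgriffiths hsinh]
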